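/- Let Q be a σ-finite stationary non-zero measure on M with intensity λ_Q ∈ (0,∞), and assume that Q-almost every ν satisfies condition (R). Then the Palm distribution 𝔓_Q of Q is invariant under every random time shift: for every x ∈ ℝ and every measurable G ⊆ M, 𝔓_Q( {ν : θ̂_x ν ∈ G} ) = 𝔓_Q(G). -/

import Mathlib

open MeasureTheory Filter Set
open scoped ENNReal NNReal

noncomputable section

/-- The additive functional of a locally finite Borel measure on `ℝ`:
`ν_t = ν((0,t])` for `t > 0` and `ν_t = -ν((t,0])` for `t ≤ 0`. -/
def addFun (ν : Measure ℝ) (t : ℝ) : ℝ :=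
  if 0 < t then (ν (Set.Ioc 0 t)).toReal else -((ν (Set.Ioc t 0)).toReal)

/-- The right-continuous inverse `ν⁻¹(x) = inf {t : ν_t > x}` of the additive functional. -/
def rcInv (ν : Measure ℝ) (x : ℝ) : ℝ :=
  sInf {t : ℝ | x < addFun ν t}

/-- The shift `θ_{-t}` acting on measures: `(θ_{-t} ν)(A) = ν(A + t)`. -/
def mshift (t : ℝ) (ν : Measure ℝ) : Measure ℝ :=
  Measure.map (fun s => s - t) ν

/-- The random time shift `θ̂_x ν = θ_{-ν⁻¹(x)} ν`, i.e. `(θ̂_x ν)(A) = ν(A + ν⁻¹(x))`. -/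
def rtShift (x : ℝ) (ν : Measure ℝ) : Measure ℝ :=
  mshift (rcInv ν x) ν

/-- `ν` satisfies condition (R): the range of its additive functional is all of `ℝ`. -/
def CondR (ν : Measure ℝ) : Prop :=
  Set.range (addFun ν) = Set.univ

open ProbabilityTheory

lemma mshift_apply' (t : ℝ) (ν : Measure ℝ) {B : Set ℝ} (hB : MeasurableSet B) :
    mshift t ν B = ν {s | s - t ∈ B} :=
  Measure.map_apply (by fun_prop) hB

lemma measurable_mshift (t : ℝ) : Measurable (mshift t) :=
  Measure.measurable_map _ (by fun_prop)

lemma mshift_mshift (a b : ℝ) (ν : Measure ℝ) : mshift a (mshift b ν) = mshift (b + a) ν := by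
  unfold mshift
  rw [Measure.map_map (by fun_prop) (by fun_prop)]
  congr 1
  funext s
  simp only [Function.comp]
  ring

lemma mshift_Ioc (t : ℝ) (ν : Measure ℝ) (a b : ℝ) :
    mshift t ν (Ioc a b) = ν (Ioc (a + t) (b + t)) := by
  rw [mshift_apply' _ _ measurableSet_Ioc]
  congr 1
  ext s
  simp only [mem_ofPred_eq, mem_Ioc]
  constructor <;> rintro ⟨h1, h2⟩ <;> constructor <;> linarith

lemma mshift_Ioi (t : ℝ) (ν : Measure ℝ) (a : ℝ) :
    mshift t ν (Ioi a) = ν (Ioi (a + t)) := by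
  rw [mshift_apply' _ _ measurableSet_Ioi]
  congr 1
  ext s
  simp only [mem_ofPred_eq, mem_Ioi]
  constructor <;> intro h1 <;> linarith

lemma mshift_Iic (t : ℝ) (ν : Measure ℝ) (a : ℝ) :
    mshift t ν (Iic a) = ν (Iic (a + t)) := by
  rw [mshift_apply' _ _ measurableSet_Iic]
  congr 1
  ext s
  simp only [mem_ofPred_eq, mem_Iic]
  constructor <;> intro h1 <;> linarith

/-- Unit intervals suffice for local finiteness. -/
lemma lf_iff (ν : Measure ℝ) :
    IsLocallyFiniteMeasure ν ↔ ∀ n : ℤ, ν (Ioc (n : ℝ) (n + 1)) < ⊤ := by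
  constructor
  · intro h n
    exact measure_Ioc_lt_top
  · intro h
    refine ⟨fun p => ⟨Ioo ((⌈p⌉ : ℝ) - 1) (⌊p⌋ + 1), ?_, ?_⟩⟩
    · apply Ioo_mem_nhds
      · linarith [Int.ceil_lt_add_one p]
      · exact Int.lt_floor_add_one p
    · have hsub : Ioo ((⌈p⌉ : ℝ) - 1) (⌊p⌋ + 1) ⊆
          Ioc (((⌈p⌉ - 1 : ℤ)) : ℝ) (((⌈p⌉ - 1 : ℤ) : ℝ) + 1) ∪ Ioc (⌊p⌋ : ℝ) (⌊p⌋ + 1) := by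
        intro y hy
        push_cast
        rcases le_or_gt y ⌈p⌉ with h1 | h1
        · left
          exact ⟨hy.1, by linarith⟩
        · right
          exact ⟨by linarith [Int.floor_le p, Int.le_ceil p], hy.2.le⟩
      exact (measure_mono hsub).trans_lt
        ((measure_union_le _ _).trans_lt (ENNReal.add_lt_top.2 ⟨h _, h _⟩))

/-- The measurable set of "regular" measures. -/
def Lset : Set (Measure ℝ) :=
  {ν | IsLocallyFiniteMeasure ν ∧ ν (Ioi 0) = ⊤ ∧ ν (Iic 0) = ⊤}

lemma measurableSet_Lset : MeasurableSet Lset := by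
  have : Lset = (⋂ n : ℤ, {ν : Measure ℝ | ν (Ioc (n : ℝ) (n + 1)) < ⊤}) ∩
      ({ν | ν (Ioi 0) = ⊤} ∩ {ν | ν (Iic 0) = ⊤}) := by
    ext ν
    simp [Lset, lf_iff]
  rw [this]
  refine MeasurableSet.inter (MeasurableSet.iInter fun n => ?_) (MeasurableSet.inter ?_ ?_)
  · exact measurableSet_lt (Measure.measurable_coe measurableSet_Ioc) measurable_const
  · exact Measure.measurable_coe measurableSet_Ioi (measurableSet_singleton _)
  · exact Measure.measurable_coe measurableSet_Iic (measurableSet_singleton _)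

lemma Lset_Ioi {ν : Measure ℝ} (h : ν ∈ Lset) (a : ℝ) : ν (Ioi a) = ⊤ := by
  obtain ⟨h1, h2, -⟩ := h
  have hsub : Ioi (0 : ℝ) ⊆ Ioc 0 a ∪ Ioi a := by
    intro y hy
    rcases le_or_gt y a with h | h
    · exact Or.inl ⟨hy, h⟩
    · exact Or.inr h
  have h3 := (measure_mono (μ := ν) hsub).trans (measure_union_le _ _)
  rw [h2, top_le_iff, ENNReal.add_eq_top] at h3
  exact h3.resolve_left measure_Ioc_lt_top.ne

lemma Lset_Iic {ν : Measure ℝ} (h : ν ∈ Lset) (a : ℝ) : ν (Iic a) = ⊤ := by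
  obtain ⟨h1, -, h2⟩ := h
  have hsub : Iic (0 : ℝ) ⊆ Ioc a 0 ∪ Iic a := by
    intro y hy
    rcases le_or_gt y a with h | h
    · exact Or.inr h
    · exact Or.inl ⟨h, hy⟩
  have h3 := (measure_mono (μ := ν) hsub).trans (measure_union_le _ _)
  rw [h2, top_le_iff, ENNReal.add_eq_top] at h3
  exact h3.resolve_left measure_Ioc_lt_top.ne

lemma Lset_mshift {ν : Measure ℝ} (h : ν ∈ Lset) (t : ℝ) : mshift t ν ∈ Lset := by
  refine ⟨?_, ?_, ?_⟩
  · rw [lf_iff]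
    intro n
    have := h.1
    rw [mshift_Ioc]
    exact measure_Ioc_lt_top
  · rw [mshift_Ioi, Lset_Ioi h]
  · rw [mshift_Iic, Lset_Iic h]

lemma addFun_eq (ν : Measure ℝ) (t : ℝ) : addFun ν t = ∫ _ in (0 : ℝ)..t, (1 : ℝ) ∂ν := by
  rw [intervalIntegral.integral_const']
  unfold addFun
  split_ifs with h
  · simp [Measure.real, Ioc_eq_empty_of_le h.le]
  · simp [Measure.real, Ioc_eq_empty_of_le (not_lt.1 h)]

lemma addFun_sub (ν : Measure ℝ) [IsLocallyFiniteMeasure ν] {a b : ℝ} (hab : a ≤ b) :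
    addFun ν b - addFun ν a = (ν (Ioc a b)).toReal := by
  rw [addFun_eq, addFun_eq, intervalIntegral.integral_interval_sub_left
    intervalIntegrable_const intervalIntegrable_const, intervalIntegral.integral_const']
  simp [Measure.real, Ioc_eq_empty_of_le hab]

lemma ofReal_addFun_sub (ν : Measure ℝ) [IsLocallyFiniteMeasure ν] {a b : ℝ} (hab : a ≤ b) :
    ENNReal.ofReal (addFun ν b - addFun ν a) = ν (Ioc a b) := by
  rw [addFun_sub ν hab, ENNReal.ofReal_toReal measure_Ioc_lt_top.ne]

lemma addFun_mono (ν : Measure ℝ) [IsLocallyFiniteMeasure ν] : Monotone (addFun ν) := by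
  intro a b hab
  have := addFun_sub ν hab
  have h2 : 0 ≤ (ν (Ioc a b)).toReal := ENNReal.toReal_nonneg
  linarith

lemma addFun_continuous (ν : Measure ℝ) [IsLocallyFiniteMeasure ν] [NullSingletonClass ν] :
    Continuous (addFun ν) := by
  have : addFun ν = fun t => ∫ _ in (0 : ℝ)..t, (1 : ℝ) ∂ν := funext (addFun_eq ν)
  rw [this]
  exact intervalIntegral.continuous_primitive (fun _ _ => intervalIntegrable_const) 0

lemma addFun_mshift (ν : Measure ℝ) [IsLocallyFiniteMeasure ν] (s u : ℝ) :
    addFun (mshift s ν) u = addFun ν (u + s) - addFun ν s := by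
  have h0 : addFun (mshift s ν) u =
      if 0 < u then (ν (Ioc s (u + s))).toReal else -(ν (Ioc (u + s) s)).toReal := by
    rw [addFun, mshift_Ioc, mshift_Ioc, zero_add]
  rw [h0]
  split_ifs with h
  · rw [← addFun_sub ν (by linarith)]
  · rw [← addFun_sub ν (by linarith)]
    ring

lemma addFun_unbdd_above {ν : Measure ℝ} (h : ν ∈ Lset) (x : ℝ) : ∃ t, x < addFun ν t := by
  have := h.1
  by_contra! hx
  have hle : ∀ n : ℕ, ν (Ioc 0 (n : ℝ)) ≤ ENNReal.ofReal (x - addFun ν 0) := by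
    intro n
    rw [← ofReal_addFun_sub ν (Nat.cast_nonneg n)]
    exact ENNReal.ofReal_le_ofReal (by linarith [hx n])
  have hU : (⋃ n : ℕ, Ioc (0 : ℝ) n) = Ioi 0 := by
    ext y
    simp only [mem_iUnion, mem_Ioc, mem_Ioi]
    exact ⟨fun ⟨n, h, _⟩ => h, fun h => (exists_nat_ge y).imp fun n hn => ⟨h, hn⟩⟩
  have hm : Monotone fun n : ℕ => Ioc (0 : ℝ) n := fun a b hab =>
    Ioc_subset_Ioc_right (by exact_mod_cast hab)
  have h1 := hm.measure_iUnion (μ := ν)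
  rw [hU, h.2.1] at h1
  have h2 := iSup_le hle
  rw [← h1] at h2
  exact ENNReal.ofReal_ne_top (top_le_iff.1 h2)

lemma addFun_unbdd_below {ν : Measure ℝ} (h : ν ∈ Lset) (x : ℝ) : ∃ t, addFun ν t < x := by
  have := h.1
  by_contra! hx
  have hle : ∀ n : ℕ, ν (Ioc (-(n : ℝ)) 0) ≤ ENNReal.ofReal (addFun ν 0 - x) := by
    intro n
    rw [← ofReal_addFun_sub ν (by simp)]
    exact ENNReal.ofReal_le_ofReal (by linarith [hx (-n)])
  have hU : (⋃ n : ℕ, Ioc (-(n : ℝ)) 0) = Iic 0 := by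
    ext y
    simp only [mem_iUnion, mem_Ioc, mem_Iic]
    exact ⟨fun ⟨n, _, h⟩ => h, fun h => (exists_nat_gt (-y)).imp fun n hn => ⟨by linarith, h⟩⟩
  have hm : Monotone fun n : ℕ => Ioc (-(n : ℝ)) 0 := fun a b hab =>
    Ioc_subset_Ioc_left (by simpa using hab)
  have h1 := hm.measure_iUnion (μ := ν)
  rw [hU, h.2.2] at h1
  have h2 := iSup_le hle
  rw [← h1] at h2
  exact ENNReal.ofReal_ne_top (top_le_iff.1 h2)

lemma S_bdd {ν : Measure ℝ} (h : ν ∈ Lset) (x : ℝ) : BddBelow {t : ℝ | x < addFun ν t} := by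
  have := h.1
  obtain ⟨t, ht⟩ := addFun_unbdd_below h x
  refine ⟨t, fun u hu => ?_⟩
  by_contra! hlt
  have := addFun_mono ν hlt.le
  simp only [mem_ofPred_eq] at hu
  linarith

/-- Measurable version of `rcInv`. -/
def rQ (x : ℝ) (ν : Measure ℝ) : ℝ :=
  (⨅ q : ℚ, if x < addFun ν q then ((q : ℝ) : EReal) else ⊤).toReal

lemma measurable_addFun (t : ℝ) : Measurable fun ν : Measure ℝ => addFun ν t := by
  unfold addFun
  split_ifs
  · exact (Measure.measurable_coe measurableSet_Ioc).ennreal_toReal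
  · exact (Measure.measurable_coe measurableSet_Ioc).ennreal_toReal.neg

lemma measurable_rQ (x : ℝ) : Measurable (rQ x) := by
  unfold rQ
  refine measurable_ereal_toReal.comp (Measurable.iInf fun q => ?_)
  exact Measurable.ite (measurableSet_lt measurable_const (measurable_addFun _))
    measurable_const measurable_const

lemma rQ_eq {ν : Measure ℝ} (h : ν ∈ Lset) (x : ℝ) : rQ x ν = rcInv ν x := by
  have := h.1
  have key : (⨅ q : ℚ, if x < addFun ν q then ((q : ℝ) : EReal) else ⊤) = ((rcInv ν x : ℝ) : EReal) := by
    apply le_antisymm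
    · refine EReal.le_of_forall_lt_iff_le.1 fun z hz => ?_
      have hz' : sInf {t : ℝ | x < addFun ν t} < z := by exact_mod_cast hz
      obtain ⟨t, ht, htz⟩ := exists_lt_of_csInf_lt (addFun_unbdd_above h x) hz'
      obtain ⟨q, hq1, hq2⟩ := exists_rat_btwn htz
      refine (iInf_le _ q).trans ?_
      have hq : x < addFun ν q := lt_of_lt_of_le ht (addFun_mono ν hq1.le)
      rw [if_pos hq]
      exact_mod_cast hq2.le
    · refine le_iInf fun q => ?_
      split_ifs with hq
      · exact_mod_cast csInf_le (S_bdd h x) hq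
      · exact le_top
  rw [rQ, key, EReal.toReal_coe]

/-- Joint measurability of sections. -/
lemma measurable_section {Ω : Type*} [MeasurableSpace Ω] (m : Ω → Measure ℝ) (hm : Measurable m)
    (hlf : ∀ ω, IsLocallyFiniteMeasure (m ω)) {T : Set (Ω × ℝ)} (hT : MeasurableSet T) :
    Measurable fun ω => m ω (Prod.mk ω ⁻¹' T) := by
  have h1 : ∀ ω, m ω (Prod.mk ω ⁻¹' T) =
      ∑' n : ℤ, (m ω).restrict (Ioc (n : ℝ) (n + 1)) (Prod.mk ω ⁻¹' T) := by
    intro ω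
    have hTω : MeasurableSet (Prod.mk ω ⁻¹' T) := measurable_prodMk_left hT
    rw [← Measure.sum_apply _ hTω, ← Measure.restrict_iUnion (pairwise_disjoint_Ioc_intCast ℝ)
      (fun _ => measurableSet_Ioc), iUnion_Ioc_intCast, Measure.restrict_univ]
  simp_rw [h1]
  refine Measurable.tsum fun n => ?_
  let κ : Kernel Ω ℝ := ⟨fun ω => (m ω).restrict (Ioc (n : ℝ) (n + 1)),
    by
      refine Measure.measurable_of_measurable_coe _ fun B hB => ?_
      simp_rw [Measure.restrict_apply hB]
      exact (Measure.measurable_coe (hB.inter measurableSet_Ioc)).comp hm⟩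
  refine Kernel.measurable_kernel_prodMk_left_of_finite (κ := κ) hT fun ω => ?_
  have := hlf ω
  exact ⟨by simp [κ, measure_Ioc_lt_top]⟩

open Classical in
/-- Truncation of a measure to `Lset`. -/
def trunc (ν : Measure ℝ) : Measure ℝ := if ν ∈ Lset then ν else 0

lemma measurable_trunc : Measurable trunc := by
  classical
  unfold trunc
  exact Measurable.ite measurableSet_Lset measurable_id measurable_const

lemma trunc_lf (ν : Measure ℝ) : IsLocallyFiniteMeasure (trunc ν) := by
  unfold trunc
  split_ifs with h
  · exact h.1
  · infer_instance

lemma trunc_eq {ν : Measure ℝ} (h : ν ∈ Lset) : trunc ν = ν := if_pos h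

/-- Jointly measurable shift. -/
def Theta (p : Measure ℝ × ℝ) : Measure ℝ := mshift p.2 (trunc p.1)

lemma Theta_eq {ν : Measure ℝ} (h : ν ∈ Lset) (t : ℝ) : Theta (ν, t) = mshift t ν := by
  simp [Theta, trunc_eq h]

lemma measurable_Theta : Measurable Theta := by
  refine Measure.measurable_of_measurable_coe _ fun B hB => ?_
  have : ∀ p : Measure ℝ × ℝ, Theta p B = trunc p.1
      (Prod.mk p ⁻¹' {z : (Measure ℝ × ℝ) × ℝ | z.2 - z.1.2 ∈ B}) := by
    intro p
    rw [Theta, mshift_apply' _ _ hB]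
    rfl
  simp_rw [this]
  refine measurable_section (fun p : Measure ℝ × ℝ => trunc p.1)
    (measurable_trunc.comp measurable_fst) (fun p => trunc_lf _) ?_
  have hf : Measurable fun z : (Measure ℝ × ℝ) × ℝ => z.2 - z.1.2 := by fun_prop
  exact hf hB


/-- The transport `s ↦ ν⁻¹(ν_s + x)`. -/
def sig (x : ℝ) (ν : Measure ℝ) (s : ℝ) : ℝ := s + rcInv (mshift s ν) x

lemma sig_mshift (x c : ℝ) (ν : Measure ℝ) (s : ℝ) :
    sig x (mshift c ν) s = sig x ν (s + c) - c := by
  unfold sig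
  rw [mshift_mshift, add_comm c s]
  ring

lemma rtShift_mshift (x : ℝ) (ν : Measure ℝ) (s : ℝ) :
    rtShift x (mshift s ν) = mshift (sig x ν s) ν := by
  rw [rtShift, mshift_mshift, sig]

lemma exists_lt_of_cont {F : ℝ → ℝ} (hF : Continuous F) {a c : ℝ} (h : c < F a) :
    ∃ t < a, c < F t := by
  have h1 : ∀ᶠ t in nhds a, c < F t := hF.continuousAt.eventually (lt_mem_nhds h)
  have h2 : ∀ᶠ t in nhdsWithin a (Iio a), c < F t := h1.filter_mono nhdsWithin_le_nhds
  obtain ⟨t, ht, ht'⟩ := (h2.and self_mem_nhdsWithin).exists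
  exact ⟨t, ht', ht⟩

lemma le_sig_iff {ν : Measure ℝ} (h : ν ∈ Lset) [NullSingletonClass ν] (x a s : ℝ) :
    a ≤ sig x ν s ↔ addFun ν a - x ≤ addFun ν s := by
  have hlf := h.1
  have hs := Lset_mshift h s
  have h1 : a ≤ sig x ν s ↔ a - s ≤ sInf {u : ℝ | x < addFun (mshift s ν) u} := by
    unfold sig rcInv
    constructor <;> intro h <;> linarith
  rw [h1, le_csInf_iff (S_bdd hs x) (addFun_unbdd_above hs x)]
  simp only [addFun_mshift, mem_ofPred_eq]
  constructor
  · intro h2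
    by_contra! h3
    obtain ⟨t, hta, ht⟩ := exists_lt_of_cont (addFun_continuous ν) (a := a)
      (c := addFun ν s + x) (by linarith)
    have := h2 (t - s) (by rw [sub_add_cancel]; linarith)
    linarith
  · intro h2 u hu
    by_contra! h3
    have := addFun_mono ν (show u + s ≤ a by linarith)
    linarith

lemma exists_level {ν : Measure ℝ} (h : ν ∈ Lset) [NullSingletonClass ν] (c : ℝ) :
    ∃ a', addFun ν a' = c ∧ ∀ s, c ≤ addFun ν s ↔ a' ≤ s := by
  have hlf := h.1
  have hne : {s | c ≤ addFun ν s}.Nonempty :=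
    (addFun_unbdd_above h c).imp fun t ht => ht.le
  have hbdd : BddBelow {s | c ≤ addFun ν s} := by
    obtain ⟨t, ht⟩ := addFun_unbdd_below h c
    refine ⟨t, fun u hu => ?_⟩
    by_contra! hlt
    have := addFun_mono ν hlt.le
    simp only [mem_ofPred_eq] at hu
    linarith
  have hcl : IsClosed {s | c ≤ addFun ν s} := isClosed_le continuous_const (addFun_continuous ν)
  have hmem : c ≤ addFun ν (sInf {s | c ≤ addFun ν s}) := hcl.csInf_mem hne hbdd
  refine ⟨sInf {s | c ≤ addFun ν s}, ?_, fun s => ⟨fun hs => csInf_le hbdd hs, fun hs => ?_⟩⟩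
  · refine le_antisymm ?_ hmem
    by_contra! hlt
    obtain ⟨t, ht, ht'⟩ := exists_lt_of_cont (addFun_continuous ν) hlt
    exact absurd (csInf_le hbdd (show t ∈ {s | c ≤ addFun ν s} from ht'.le)) (not_le.2 ht)
  · exact hmem.trans (addFun_mono ν hs)

lemma measurable_sig {ν : Measure ℝ} (h : ν ∈ Lset) [NullSingletonClass ν] (x : ℝ) :
    Measurable (sig x ν) := by
  refine measurable_of_Ici fun a => ?_
  obtain ⟨a', -, ha'⟩ := exists_level h (addFun ν a - x)
  have : sig x ν ⁻¹' Ici a = Ici a' := by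
    ext s
    simp only [mem_preimage, mem_Ici, le_sig_iff h, ha']
  rw [this]
  exact measurableSet_Ici

lemma map_sig {ν : Measure ℝ} (h : ν ∈ Lset) [NullSingletonClass ν] (x : ℝ) :
    Measure.map (sig x ν) ν = ν := by
  have hlf := h.1
  symm
  refine Measure.ext_of_Ico _ _ fun a b hab => ?_
  rw [Measure.map_apply (measurable_sig h x) measurableSet_Ico]
  obtain ⟨a', hFa, ha'⟩ := exists_level h (addFun ν a - x)
  obtain ⟨b', hFb, hb'⟩ := exists_level h (addFun ν b - x)
  have hset : sig x ν ⁻¹' Ico a b = Ico a' b' := by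
    ext s
    simp only [mem_preimage, mem_Ico, ← not_le, le_sig_iff h, ha', hb']
  have hle : a' ≤ b' := by
    rw [← ha', hFb]
    linarith [addFun_mono ν hab.le]
  rw [hset, measure_congr (Ico_ae_eq_Ioc (μ := ν) (a := a) (b := b)),
    measure_congr (Ico_ae_eq_Ioc (μ := ν) (a := a') (b := b')),
    ← ofReal_addFun_sub ν hle, ← ofReal_addFun_sub ν hab.le, hFa, hFb]
  congr 1
  ring

/-- Good measures. -/
def Good (ν : Measure ℝ) : Prop := ν ∈ Lset ∧ NullSingletonClass ν

lemma good_of_condR {ν : Measure ℝ} (hlf : IsLocallyFiniteMeasure ν) (hR : CondR ν) : Good ν := by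
  have hsurj : ∀ y, ∃ t, addFun ν t = y := fun y => by
    have : y ∈ Set.range (addFun ν) := by rw [hR]; trivial
    exact this
  refine ⟨⟨hlf, ?_, ?_⟩, ⟨fun p => ?_⟩⟩
  · by_contra hne
    obtain ⟨t, ht⟩ := hsurj (addFun ν 0 + (ν (Ioi 0)).toReal + 1)
    have hpos : 0 ≤ (ν (Ioi 0)).toReal := ENNReal.toReal_nonneg
    rcases le_total 0 t with h0 | h0
    · have h1 := addFun_sub ν h0
      have h2 : (ν (Ioc 0 t)).toReal ≤ (ν (Ioi 0)).toReal :=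
        ENNReal.toReal_mono hne (measure_mono Ioc_subset_Ioi_self)
      linarith
    · have := addFun_mono ν h0
      linarith
  · by_contra hne
    obtain ⟨t, ht⟩ := hsurj (addFun ν 0 - (ν (Iic 0)).toReal - 1)
    have hpos : 0 ≤ (ν (Iic 0)).toReal := ENNReal.toReal_nonneg
    rcases le_total t 0 with h0 | h0
    · have h1 := addFun_sub ν h0
      have h2 : (ν (Ioc t 0)).toReal ≤ (ν (Iic 0)).toReal :=
        ENNReal.toReal_mono hne (measure_mono Ioc_subset_Iic_self)
      linarith
    · have := addFun_mono ν h0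
      linarith
  · by_contra hne
    have hfin : ν {p} ≠ ⊤ := (measure_singleton_lt_top (μ := ν)).ne
    have hpos : 0 < (ν {p}).toReal := ENNReal.toReal_pos hne hfin
    obtain ⟨t, ht⟩ := hsurj (addFun ν p - (ν {p}).toReal / 2)
    rcases lt_or_ge t p with h0 | h0
    · have h1 := addFun_sub ν h0.le
      have h2 : (ν {p}).toReal ≤ (ν (Ioc t p)).toReal :=
        ENNReal.toReal_mono measure_Ioc_lt_top.ne
          (measure_mono (singleton_subset_iff.2 ⟨h0, le_rfl⟩))
      linarith
    · have := addFun_mono ν h0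
      linarith

/-- The transported mass functional. -/
def fE (x : ℝ) (G : Set (Measure ℝ)) (E : Set (ℝ × ℝ)) (ν : Measure ℝ) : ℝ≥0∞ :=
  ν {s | (s, sig x ν s) ∈ E ∧ mshift (sig x ν s) ν ∈ G}

/-- Measurable version of the defining set. -/
def Tset (x : ℝ) (G : Set (Measure ℝ)) (E : Set (ℝ × ℝ)) : Set (Measure ℝ × ℝ) :=
  {p | (p.2, p.2 + rQ x (Theta p)) ∈ E ∧ Theta (p.1, p.2 + rQ x (Theta p)) ∈ G}

lemma measurableSet_Tset (x : ℝ) {G : Set (Measure ℝ)} (hG : MeasurableSet G)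
    {E : Set (ℝ × ℝ)} (hE : MeasurableSet E) : MeasurableSet (Tset x G E) := by
  have h1 : Measurable fun p : Measure ℝ × ℝ => p.2 + rQ x (Theta p) :=
    measurable_snd.add ((measurable_rQ x).comp measurable_Theta)
  exact ((measurable_snd.prodMk h1) hE).inter
    ((measurable_Theta.comp (measurable_fst.prodMk h1)) hG)

lemma Tset_section (x : ℝ) (G : Set (Measure ℝ)) (E : Set (ℝ × ℝ)) {ν : Measure ℝ}
    (h : ν ∈ Lset) :
    {s | (s, sig x ν s) ∈ E ∧ mshift (sig x ν s) ν ∈ G} = Prod.mk ν ⁻¹' Tset x G E := by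
  ext s
  have : s + rQ x (Theta (ν, s)) = sig x ν s := by
    rw [Theta_eq h, rQ_eq (Lset_mshift h s), sig]
  simp only [Tset, mem_preimage, mem_ofPred_eq, this]
  rw [Theta_eq h]

lemma measurableSet_fE (x : ℝ) {G : Set (Measure ℝ)} (hG : MeasurableSet G)
    {E : Set (ℝ × ℝ)} (hE : MeasurableSet E) {ν : Measure ℝ} (h : ν ∈ Lset) :
    MeasurableSet {s | (s, sig x ν s) ∈ E ∧ mshift (sig x ν s) ν ∈ G} := by
  rw [Tset_section x G E h]
  exact measurable_prodMk_left (measurableSet_Tset x hG hE)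

lemma aemeasurable_fE (Q : Measure (Measure ℝ)) (hgood : ∀ᵐ ν ∂Q, Good ν) (x : ℝ)
    {G : Set (Measure ℝ)} (hG : MeasurableSet G) {E : Set (ℝ × ℝ)} (hE : MeasurableSet E) :
    AEMeasurable (fE x G E) Q := by
  refine ⟨fun ν => trunc ν (Prod.mk ν ⁻¹' Tset x G E),
    measurable_section trunc measurable_trunc trunc_lf (measurableSet_Tset x hG hE), ?_⟩
  filter_upwards [hgood] with ν hν
  rw [fE, Tset_section x G E hν.1, trunc_eq hν.1]

lemma fE_mshift (x c : ℝ) {G : Set (Measure ℝ)} (hG : MeasurableSet G) {E : Set (ℝ × ℝ)}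
    (hE : MeasurableSet E) {ν : Measure ℝ} (h : ν ∈ Lset) :
    fE x G E (mshift c ν) = fE x G {p | (p.1 - c, p.2 - c) ∈ E} ν := by
  rw [fE, mshift_apply' _ _ (measurableSet_fE x hG hE (Lset_mshift h c)), fE]
  congr 1
  ext s
  simp only [mem_ofPred_eq, sig_mshift, mshift_mshift, sub_add_cancel, add_sub_cancel]

lemma lintegral_fE_shift (Q : Measure (Measure ℝ)) (hgood : ∀ᵐ ν ∂Q, Good ν)
    (hstat : ∀ t : ℝ, Measure.map (mshift t) Q = Q) (x c : ℝ)
    {G : Set (Measure ℝ)} (hG : MeasurableSet G) {E : Set (ℝ × ℝ)} (hE : MeasurableSet E) :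
    ∫⁻ ν, fE x G E ν ∂Q = ∫⁻ ν, fE x G {p | (p.1 - c, p.2 - c) ∈ E} ν ∂Q := by
  have h1 : ∫⁻ ν, fE x G E ν ∂Q = ∫⁻ ν, fE x G E (mshift c ν) ∂Q := by
    rw [← lintegral_map' _ (measurable_mshift c).aemeasurable, hstat c]
    rw [hstat c]
    exact aemeasurable_fE Q hgood x hG hE
  rw [h1]
  refine lintegral_congr_ae ?_
  filter_upwards [hgood] with ν hν
  exact fE_mshift x c hG hE hν.1

lemma lintegral_fE_iUnion (Q : Measure (Measure ℝ)) (hgood : ∀ᵐ ν ∂Q, Good ν) (x : ℝ)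
    {G : Set (Measure ℝ)} (hG : MeasurableSet G) {E : ℤ → Set (ℝ × ℝ)}
    (hE : ∀ n, MeasurableSet (E n)) (hd : Pairwise (Function.onFun Disjoint E)) :
    ∫⁻ ν, fE x G (⋃ n, E n) ν ∂Q = ∑' n, ∫⁻ ν, fE x G (E n) ν ∂Q := by
  rw [← lintegral_tsum fun n => aemeasurable_fE Q hgood x hG (hE n)]
  refine lintegral_congr_ae ?_
  filter_upwards [hgood] with ν hν
  simp only [fE]
  rw [← measure_iUnion _ fun n => measurableSet_fE x hG (hE n) hν.1]
  · congr 1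
    ext s
    simp
  · intro i j hij
    refine Set.disjoint_left.2 fun s hs hs' => ?_
    exact Set.disjoint_left.1 (hd hij) hs.1 hs'.1

/-- Mass transport. -/
lemma mass_transport (Q : Measure (Measure ℝ)) (hgood : ∀ᵐ ν ∂Q, Good ν)
    (hstat : ∀ t : ℝ, Measure.map (mshift t) Q = Q) (x : ℝ)
    {G : Set (Measure ℝ)} (hG : MeasurableSet G) :
    ∫⁻ ν, fE x G (Ioc 0 1 ×ˢ univ) ν ∂Q = ∫⁻ ν, fE x G (univ ×ˢ Ioc 0 1) ν ∂Q := by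
  have hdis := pairwise_disjoint_Ioc_intCast ℝ
  have e1 : (Ioc (0 : ℝ) 1 ×ˢ (univ : Set ℝ)) =
      ⋃ n : ℤ, Ioc (0 : ℝ) 1 ×ˢ Ioc (n : ℝ) (n + 1) := by
    rw [← prod_iUnion, iUnion_Ioc_intCast]
  have e2 : ((univ : Set ℝ) ×ˢ Ioc (0 : ℝ) 1) =
      ⋃ n : ℤ, Ioc (n : ℝ) (n + 1) ×ˢ Ioc (0 : ℝ) 1 := by
    rw [← iUnion_prod_const, iUnion_Ioc_intCast]
  rw [e1, e2, lintegral_fE_iUnion Q hgood x hG (fun n => measurableSet_Ioc.prod measurableSet_Ioc),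
    lintegral_fE_iUnion Q hgood x hG (fun n => measurableSet_Ioc.prod measurableSet_Ioc),
    ← (Equiv.neg ℤ).tsum_eq]
  · refine tsum_congr fun n => ?_
    rw [lintegral_fE_shift Q hgood hstat x n hG (measurableSet_Ioc.prod measurableSet_Ioc)]
    congr 1
    funext ν
    congr 1
    ext p
    simp only [mem_ofPred_eq, mem_prod, mem_Ioc, Equiv.neg_apply, Int.cast_neg]
    constructor <;> rintro ⟨⟨h1, h2⟩, h3, h4⟩ <;> refine ⟨⟨?_, ?_⟩, ?_, ?_⟩ <;> linarith
  · intro i j hij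
    exact Set.disjoint_prod.2 (Or.inl (hdis hij))
  · intro i j hij
    exact Set.disjoint_prod.2 (Or.inr (hdis hij))

/-- **Duality lemma.** Let `Q` be a σ-finite stationary non-zero measure on the space of
locally finite measures on `ℝ` with intensity `λ_Q ∈ (0,∞)`, such that `Q`-almost every
`ν` satisfies condition (R). Then the Palm distribution `𝔓_Q` of `Q` is invariant under
every random time shift `θ̂_x`. -/
theorem palm_invariant_under_random_time_shifts
    (Q : Measure (Measure ℝ)) [SigmaFinite Q]
    (hstat : ∀ t : ℝ, Measure.map (mshift t) Q = Q)
    (hnz : Q {(0 : Measure ℝ)} = 0)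
    (lamQ : ℝ≥0∞) (hlam : lamQ = ∫⁻ ν, ν (Set.Ioc 0 1) ∂Q)
    (hlam0 : 0 < lamQ) (hlamfin : lamQ < ⊤)
    (hR : ∀ᵐ ν ∂Q, CondR ν)
    (P : Measure (Measure ℝ)) [IsProbabilityMeasure P]
    (hP : ∀ G : Set (Measure ℝ), MeasurableSet G →
      P G = lamQ⁻¹ * ∫⁻ ν, ν {t ∈ Set.Ioc (0 : ℝ) 1 | mshift t ν ∈ G} ∂Q) :
    ∀ x : ℝ, ∀ G : Set (Measure ℝ), MeasurableSet G →
      P {ν | rtShift x ν ∈ G} = P G := by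
  intro x G hG
  have hm1 : Measurable fun ν : Measure ℝ => ν (Ioc (0 : ℝ) 1) :=
    Measure.measurable_coe measurableSet_Ioc
  have hlf : ∀ᵐ ν ∂Q, ∀ n : ℤ, ν (Ioc (n : ℝ) (n + 1)) < ⊤ := by
    rw [ae_all_iff]
    intro n
    have h1 : ∫⁻ ν, ν (Ioc (n : ℝ) (n + 1)) ∂Q = lamQ := by
      rw [hlam]
      conv_rhs => rw [← hstat n]
      rw [lintegral_map hm1 (measurable_mshift n)]
      simp_rw [mshift_Ioc, zero_add, add_comm (1 : ℝ)]
    exact ae_lt_top (Measure.measurable_coe measurableSet_Ioc) (by rw [h1]; exact hlamfin.ne)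
  have hgood : ∀ᵐ ν ∂Q, Good ν := by
    filter_upwards [hR, hlf] with ν h1 h2
    exact good_of_condR ((lf_iff ν).2 h2) h1
  have hPL : ∀ᵐ ν ∂P, ν ∈ Lset := by
    change P Lsetᶜ = 0
    rw [hP _ measurableSet_Lset.compl]
    have : ∫⁻ ν, ν {t ∈ Set.Ioc (0 : ℝ) 1 | mshift t ν ∈ Lsetᶜ} ∂Q = ∫⁻ _, 0 ∂Q := by
      refine lintegral_congr_ae ?_
      filter_upwards [hgood] with ν hν
      have : {t ∈ Set.Ioc (0 : ℝ) 1 | mshift t ν ∈ Lsetᶜ} = ∅ := by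
        ext t
        simp [Lset_mshift hν.1 t]
      rw [this, measure_empty]
    rw [this]
    simp
  have hG' : MeasurableSet {ν | ν ∈ Lset ∧ rtShift x ν ∈ G} := by
    have : {ν | ν ∈ Lset ∧ rtShift x ν ∈ G} = Lset ∩ (fun ν => Theta (ν, rQ x ν)) ⁻¹' G := by
      ext ν
      simp only [mem_ofPred_eq, mem_inter_iff, mem_preimage]
      refine and_congr_right fun h => ?_
      rw [Theta_eq h, rQ_eq h, rtShift]
    rw [this]
    exact measurableSet_Lset.inter
      ((measurable_Theta.comp (measurable_id.prodMk (measurable_rQ x))) hG)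
  have hcongr : P {ν | rtShift x ν ∈ G} = P {ν | ν ∈ Lset ∧ rtShift x ν ∈ G} := by
    refine measure_congr ?_
    filter_upwards [hPL] with ν hν
    exact propext ⟨fun h => ⟨hν, h⟩, fun h => h.2⟩
  rw [hcongr, hP _ hG', hP _ hG]
  congr 1
  have hA : ∫⁻ ν, ν {t ∈ Set.Ioc (0 : ℝ) 1 | mshift t ν ∈ {ν | ν ∈ Lset ∧ rtShift x ν ∈ G}} ∂Q =
      ∫⁻ ν, fE x G (Ioc 0 1 ×ˢ univ) ν ∂Q := by
    refine lintegral_congr_ae ?_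
    filter_upwards [hgood] with ν hν
    rw [fE]
    congr 1
    ext t
    simp [Lset_mshift hν.1 t, rtShift_mshift]
  have hB : ∫⁻ ν, ν {t ∈ Set.Ioc (0 : ℝ) 1 | mshift t ν ∈ G} ∂Q =
      ∫⁻ ν, fE x G (univ ×ˢ Ioc 0 1) ν ∂Q := by
    refine lintegral_congr_ae ?_
    filter_upwards [hgood] with ν hν
    have := hν.2
    have hms : MeasurableSet {t ∈ Set.Ioc (0 : ℝ) 1 | mshift t ν ∈ G} := by
      have : {t ∈ Set.Ioc (0 : ℝ) 1 | mshift t ν ∈ G} =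
          Ioc 0 1 ∩ (fun t => Theta (ν, t)) ⁻¹' G := by
        ext t
        simp [Theta_eq hν.1]
      rw [this]
      exact measurableSet_Ioc.inter ((measurable_Theta.comp measurable_prodMk_left) hG)
    have h2 : ν {t ∈ Set.Ioc (0 : ℝ) 1 | mshift t ν ∈ G} =
        Measure.map (sig x ν) ν {t ∈ Set.Ioc (0 : ℝ) 1 | mshift t ν ∈ G} := by
      rw [map_sig hν.1 x]
    rw [h2, Measure.map_apply (measurable_sig hν.1 x) hms, fE]
    congr 1
    ext t
    simp
  rw [hA, hB]
  exact mass_transport Q hgood hstat x hG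

end
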